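/- Let f be N times continuously differentiable on [a,b], let N̂ ∈ ℕ, and let b_{i,j} (0 ≤ j ≤ N, 0 ≤ i ≤ d_j) be real numbers such that Σ_{j=0}^N Σ_{i=0}^{d_j} b_{i,j} m̂_{i,j,k} = 0 for every k = 0, 1, …, N̂. Then for every k = 0, 1, …, N̂: ∫_a^b x^k (x−a)^N (x−b)^N · Σ_{j=0}^N ( Σ_{i=0}^{d_j} b_{i,j} x^i ) f^{(j)}(x) dx = 0. (That is, any vector in the null space of the moment matrix H yields a differential operator Op_b with polynomial coefficients for which the first N̂+1 moments of (x−a)^N(x−b)^N·(Op_b f) vanish.) -/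

import Mathlib

open Finset intervalIntegral Polynomial

/-- The falling factorial `(x)_j = x(x−1)⋯(x−j+1)`, with `(x)_0 = 1`. -/
noncomputable def fallingFactorial (x : ℝ) (j : ℕ) : ℝ :=
  ∏ l ∈ Finset.range j, (x - l)

/-- The shifted moment sequence
`m̂_{i,j,k} = Σ_{t=0}^{2N} δ_t (−1)^j (i+k+t)_j m_{k+t+i−j}`, where `δ_t` is the
coefficient of `X^t` in `((X−a)(X−b))^N` and `m` is an (extended) moment sequence. -/
noncomputable def shiftedMoment (a b : ℝ) (N : ℕ) (m : ℤ → ℝ) (i j k : ℕ) : ℝ :=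
  ∑ t ∈ Finset.range (2 * N + 1),
    (((Polynomial.X - Polynomial.C a) * (Polynomial.X - Polynomial.C b)) ^ N).coeff t *
      (-1) ^ j * fallingFactorial ((i : ℝ) + k + t) j * m ((k : ℤ) + t + i - j)

/-- The falling factorial at a natural number is the descending factorial. -/
theorem fallingFactorial_natCast (n j : ℕ) :
    fallingFactorial (n : ℝ) j = n.descFactorial j := by
  induction j with
  | zero => simp [fallingFactorial]
  | succ j ih =>
    rw [fallingFactorial, Finset.prod_range_succ, ← fallingFactorial, ih, Nat.descFactorial_succ]
    rcases le_or_gt j n with h | h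
    · push_cast [Nat.cast_sub h]
      ring
    · simp [Nat.descFactorial_of_lt h]

/-- Repeated integration by parts against a polynomial that vanishes to order `j` at both
endpoints. -/
theorem integral_eval_mul_iteratedDerivWithin {a b : ℝ} (hab : a < b) {N : ℕ} {f : ℝ → ℝ}
    (hf : ContDiffOn ℝ N f (Set.Icc a b)) {j : ℕ} (hj : j ≤ N) (p : ℝ[X])
    (hp : ((X - C a) * (X - C b)) ^ j ∣ p) :
    ∫ x in a..b, p.eval x * iteratedDerivWithin j f (Set.Icc a b) x =
      (-1) ^ j * ∫ x in a..b, (derivative^[j] p).eval x * f x := by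
  have hs : UniqueDiffOn ℝ (Set.Icc a b) := uniqueDiffOn_Icc hab
  induction j generalizing p with
  | zero => simp
  | succ j ih =>
    have hlt : ((j : ℕ) : WithTop ℕ∞) < (N : ℕ) := by exact_mod_cast hj
    have hroot : p.eval a = 0 ∧ p.eval b = 0 := by
      obtain ⟨r, rfl⟩ := hp
      simp
    have hdiff := hf.differentiableOn_iteratedDerivWithin hlt hs
    have hcont : ContinuousOn (iteratedDerivWithin (j + 1) f (Set.Icc a b)) (Set.Icc a b) :=
      hf.continuousOn_iteratedDerivWithin (by exact_mod_cast hj) hs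
    have hderiv : ∀ x ∈ Set.uIcc a b, HasDerivWithinAt (iteratedDerivWithin j f (Set.Icc a b))
        (iteratedDerivWithin (j + 1) f (Set.Icc a b) x) (Set.uIcc a b) x := by
      rw [Set.uIcc_of_le hab.le, iteratedDerivWithin_succ]
      exact fun x hx => (hdiff x hx).hasDerivWithinAt
    have hparts := integral_mul_deriv_eq_deriv_mul_of_hasDerivWithinAt
      (a := a) (b := b) (u := fun x => p.eval x) (u' := fun x => (derivative p).eval x)
      (v := iteratedDerivWithin j f (Set.Icc a b))
      (v' := iteratedDerivWithin (j + 1) f (Set.Icc a b))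
      (fun x _ => (p.hasDerivAt x).hasDerivWithinAt)
      hderiv
      ((derivative p).continuous.intervalIntegrable a b)
      (ContinuousOn.intervalIntegrable (by rwa [Set.uIcc_of_le hab.le]))
    have hp' := pow_sub_one_dvd_derivative_of_pow_dvd hp
    rw [Nat.add_sub_cancel] at hp'
    rw [hparts, hroot.1, hroot.2, ih (by omega) (derivative p) hp',
      Function.iterate_succ_apply]
    ring

/-- The shifted moments are the integrals of `f⁽ʲ⁾` against `x ^ (i + k) * ((x - a) (x - b)) ^ N`. -/
theorem shiftedMoment_eq_integral {a b : ℝ} (hab : a < b) {N : ℕ} {f : ℝ → ℝ}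
    (hf : ContDiffOn ℝ N f (Set.Icc a b)) {m : ℤ → ℝ}
    (hm : ∀ k : ℕ, m k = ∫ x in a..b, x ^ k * f x) {j : ℕ} (hj : j ≤ N) (i k : ℕ) :
    shiftedMoment a b N m i j k =
      ∫ x in a..b, (X ^ (i + k) * ((X - C a) * (X - C b)) ^ N : ℝ[X]).eval x *
        iteratedDerivWithin j f (Set.Icc a b) x := by
  rw [integral_eval_mul_iteratedDerivWithin hab hf hj _ ((pow_dvd_pow _ hj).mul_left _)]
  set q : ℝ[X] := ((X - C a) * (X - C b)) ^ N with hq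
  have hdeg : q.natDegree < 2 * N + 1 := by
    have h : ((X - C a) * (X - C b) : ℝ[X]).natDegree = 2 := by
      rw [natDegree_mul (X_sub_C_ne_zero a) (X_sub_C_ne_zero b)]
      simp
    rw [hq, natDegree_pow, h]
    omega
  have hexp : (X ^ (i + k) * q : ℝ[X]) =
      ∑ t ∈ Finset.range (2 * N + 1), C (q.coeff t) * X ^ (i + k + t) := by
    conv_lhs => rw [q.as_sum_range' _ hdeg, Finset.mul_sum]
    refine Finset.sum_congr rfl fun t _ => ?_
    rw [← C_mul_X_pow_eq_monomial, pow_add]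
    ring
  have heval : ∀ x, (derivative^[j] (X ^ (i + k) * q)).eval x * f x =
      ∑ t ∈ Finset.range (2 * N + 1),
        q.coeff t * ((i + k + t).descFactorial j : ℝ) * (x ^ (i + k + t - j) * f x) := by
    intro x
    rw [hexp, iterate_derivative_sum, eval_finsetSum, Finset.sum_mul]
    refine Finset.sum_congr rfl fun t _ => ?_
    rw [iterate_derivative_C_mul, iterate_derivative_X_pow_eq_C_mul]
    simp only [eval_mul, eval_C, eval_pow, eval_X]
    ring
  have hfc : ContinuousOn f (Set.uIcc a b) := by
    rw [Set.uIcc_of_le hab.le]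
    exact hf.continuousOn
  simp_rw [heval]
  rw [intervalIntegral.integral_finsetSum fun t _ => ContinuousOn.intervalIntegrable (by fun_prop),
    Finset.mul_sum, shiftedMoment]
  refine Finset.sum_congr rfl fun t _ => ?_
  rw [intervalIntegral.integral_const_mul, ← hm, ← hq,
    show (i : ℝ) + k + t = ((i + k + t : ℕ) : ℝ) by push_cast; ring, fallingFactorial_natCast]
  rcases le_or_gt j (i + k + t) with h | h
  · rw [show (k : ℤ) + t + i - j = ((i + k + t - j : ℕ) : ℤ) by omega]
    ring
  · simp [Nat.descFactorial_of_lt h]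

theorem nullspace_of_H_gives_vanishing_moments (a b : ℝ) (hab : a < b)
    (N : ℕ) (hN : 1 ≤ N) (d : ℕ → ℕ) (f : ℝ → ℝ)
    (hf : ContDiffOn ℝ (N : ℕ) f (Set.Icc a b))
    (m : ℤ → ℝ)
    (hm : ∀ k : ℕ, m k = ∫ x in a..b, x ^ k * f x)
    (hm0 : ∀ k : ℤ, k < 0 → m k = 0)
    (Nhat : ℕ) (B : ℕ → ℕ → ℝ)
    (hB : ∀ k ≤ Nhat, ∑ j ∈ Finset.range (N + 1), ∑ i ∈ Finset.range (d j + 1),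
      B i j * shiftedMoment a b N m i j k = 0) :
    ∀ k ≤ Nhat,
      ∫ x in a..b, x ^ k * (x - a) ^ N * (x - b) ^ N *
        ∑ j ∈ Finset.range (N + 1),
          (∑ i ∈ Finset.range (d j + 1), B i j * x ^ i) *
            iteratedDerivWithin j f (Set.Icc a b) x = 0 := by
  intro k hk
  have hcont : ∀ j ∈ Finset.range (N + 1),
      ContinuousOn (iteratedDerivWithin j f (Set.Icc a b)) (Set.uIcc a b) := fun j hj => by
    rw [Set.uIcc_of_le hab.le]
    exact hf.continuousOn_iteratedDerivWithin
      (by exact_mod_cast Nat.lt_succ_iff.mp (Finset.mem_range.mp hj)) (uniqueDiffOn_Icc hab)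
  have hint : ∀ j ∈ Finset.range (N + 1), ∀ i : ℕ, IntervalIntegrable
      (fun x => B i j * ((X ^ (i + k) * ((X - C a) * (X - C b)) ^ N : ℝ[X]).eval x *
        iteratedDerivWithin j f (Set.Icc a b) x)) MeasureTheory.volume a b := fun j hj i =>
    (continuousOn_const.mul
      ((Polynomial.continuous _).continuousOn.mul (hcont j hj))).intervalIntegrable
  calc
    _ = ∫ x in a..b, ∑ j ∈ Finset.range (N + 1), ∑ i ∈ Finset.range (d j + 1),
          B i j * ((X ^ (i + k) * ((X - C a) * (X - C b)) ^ N : ℝ[X]).eval x *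
            iteratedDerivWithin j f (Set.Icc a b) x) := by
      refine intervalIntegral.integral_congr fun x _ => ?_
      simp only [Finset.mul_sum, Finset.sum_mul]
      refine Finset.sum_congr rfl fun j _ => Finset.sum_congr rfl fun i _ => ?_
      simp only [eval_mul, eval_pow, eval_sub, eval_X, eval_C, mul_pow, pow_add]
      ring
    _ = ∑ j ∈ Finset.range (N + 1), ∑ i ∈ Finset.range (d j + 1),
          B i j * shiftedMoment a b N m i j k := by
      rw [intervalIntegral.integral_finsetSum fun j hj => by
        simpa only [Finset.sum_fn] using
          IntervalIntegrable.sum (Finset.range (d j + 1)) fun i _ => hint j hj i]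
      refine Finset.sum_congr rfl fun j hj => ?_
      rw [intervalIntegral.integral_finsetSum fun i _ => hint j hj i]
      refine Finset.sum_congr rfl fun i _ => ?_
      rw [intervalIntegral.integral_const_mul, shiftedMoment_eq_integral hab hf hm
        (Nat.lt_succ_iff.mp (Finset.mem_range.mp hj))]
    _ = 0 := hB k hk
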